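/- (Rate of the Nesterov-accelerated primal-dual method) Assume the accelerated primal-dual setting with θ₁ = 1, 1/θ_{k+1} = (1 + √(1 + 4/θ_k²))/2 for k ≥ 1, and that there exist constants 0 < λ₂ ≤ λ_max with ⟨Bz, z⟩ ≤ λ_max‖z‖² for all z ∈ ℝ^{m×d} and ⟨Bz, z⟩ ≥ λ₂‖z‖² for all z ∈ C^⊥. Set η = λ₂/λ_max, and for an integer T ≥ 2 choose ν = √η, γ = ν/(νL_f + T) and τ = 1/(νTλ_max). Let x* be a minimizer of f over C, R_x = ‖u¹ − x*‖² and R_y = ‖∇f(x*)‖². Then G(u^T, x*) ≤ 2 L_f R_x / T² + 2 (R_x + R_y) / (√η · T). -/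

import Mathlib

/-- Frobenius inner product on real m×d matrices. -/
noncomputable def ip {m d : ℕ} (x y : Matrix (Fin m) (Fin d) ℝ) : ℝ :=
  ∑ i, ∑ j, x i j * y i j

/-- The consensus subspace C = {1ₘ xᵀ : x ∈ ℝᵈ}. -/
def cC (m d : ℕ) : Set (Matrix (Fin m) (Fin d) ℝ) :=
  {x | ∃ v : Fin d → ℝ, ∀ i j, x i j = v j}

/-- The orthogonal complement C^⊥ = {y : 1ₘᵀ y = 0}. -/
def cPerp (m d : ℕ) : Set (Matrix (Fin m) (Fin d) ℝ) :=
  {y | ∀ j, ∑ i, y i j = 0}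

/-- The Bregman distance G(x, x*) = f(x) − f(x*) − ⟨∇f(x*), x − x*⟩. -/
noncomputable def breg {m d : ℕ} (f : Matrix (Fin m) (Fin d) ℝ → ℝ)
    (gf : Matrix (Fin m) (Fin d) ℝ → Matrix (Fin m) (Fin d) ℝ)
    (x xs : Matrix (Fin m) (Fin d) ℝ) : ℝ :=
  f x - f xs - ip (gf xs) (x - xs)

section helpers
variable {m d : ℕ}

theorem ip_add_l (x y z : Matrix (Fin m) (Fin d) ℝ) : ip (x + y) z = ip x z + ip y z := by
  simp [ip, add_mul, Finset.sum_add_distrib]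

theorem ip_sub_l (x y z : Matrix (Fin m) (Fin d) ℝ) : ip (x - y) z = ip x z - ip y z := by
  simp [ip, sub_mul, Finset.sum_sub_distrib]

theorem ip_smul_l (c : ℝ) (x z : Matrix (Fin m) (Fin d) ℝ) : ip (c • x) z = c * ip x z := by
  simp [ip, Finset.mul_sum, mul_assoc]

theorem ip_neg_l (x z : Matrix (Fin m) (Fin d) ℝ) : ip (-x) z = - ip x z := by
  simp [ip]

theorem ip_comm' (x y : Matrix (Fin m) (Fin d) ℝ) : ip x y = ip y x := by
  simp [ip, mul_comm]

theorem ip_add_r (x y z : Matrix (Fin m) (Fin d) ℝ) : ip x (y + z) = ip x y + ip x z := by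
  rw [ip_comm', ip_add_l, ip_comm' y, ip_comm' z]

theorem ip_sub_r (x y z : Matrix (Fin m) (Fin d) ℝ) : ip x (y - z) = ip x y - ip x z := by
  rw [ip_comm', ip_sub_l, ip_comm' y, ip_comm' z]

theorem ip_smul_r (c : ℝ) (x z : Matrix (Fin m) (Fin d) ℝ) : ip x (c • z) = c * ip x z := by
  rw [ip_comm', ip_smul_l, ip_comm' z]

theorem ip_zero_l (z : Matrix (Fin m) (Fin d) ℝ) : ip 0 z = 0 := by simp [ip]

theorem ip_self_nonneg (x : Matrix (Fin m) (Fin d) ℝ) : 0 ≤ ip x x :=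
  Finset.sum_nonneg fun _ _ => Finset.sum_nonneg fun _ _ => mul_self_nonneg _

theorem ip_self_eq_zero (x : Matrix (Fin m) (Fin d) ℝ) (h : ip x x = 0) : x = 0 := by
  have h1 : ∀ i ∈ Finset.univ, (0:ℝ) ≤ ∑ j, x i j * x i j := fun i _ =>
    Finset.sum_nonneg fun j _ => mul_self_nonneg _
  ext i j
  have h2 := (Finset.sum_eq_zero_iff_of_nonneg h1).1 h i (Finset.mem_univ i)
  have h3 := (Finset.sum_eq_zero_iff_of_nonneg
    (fun j _ => mul_self_nonneg (x i j))).1 h2 j (Finset.mem_univ j)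
  simpa using h3

theorem ip_trace (x y : Matrix (Fin m) (Fin d) ℝ) : ip x y = (x.transpose * y).trace := by
  simp only [ip, Matrix.trace, Matrix.diag, Matrix.mul_apply, Matrix.transpose_apply]
  exact Finset.sum_comm

theorem ip_mul_symm (M : Matrix (Fin m) (Fin m) ℝ) (hM : M.PosSemidef) (x y : Matrix (Fin m) (Fin d) ℝ) :
    ip (M * x) y = ip x (M * y) := by
  have h : M.transpose = M := by
    have := hM.isHermitian
    simpa [Matrix.IsHermitian, Matrix.conjTranspose_eq_transpose_of_trivial] using this
  rw [ip_trace, ip_trace, Matrix.transpose_mul, h, Matrix.mul_assoc]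

theorem ip_psd (M : Matrix (Fin m) (Fin m) ℝ) (hM : M.PosSemidef) (x : Matrix (Fin m) (Fin d) ℝ) :
    0 ≤ ip (M * x) x := by
  have h := (hM.conjTranspose_mul_mul_same x).trace_nonneg
  rw [Matrix.conjTranspose_eq_transpose_of_trivial, Matrix.mul_assoc] at h
  rw [ip_comm', ip_trace]
  exact h

/-- a symmetric matrix killing the all-ones vector is orthogonal to consensus -/
theorem mul_cons (M : Matrix (Fin m) (Fin m) ℝ)
    (h1 : M.mulVec (fun _ => (1 : ℝ)) = 0) (xs : Matrix (Fin m) (Fin d) ℝ) (hx : xs ∈ cC m d) : M * xs = 0 := by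
  obtain ⟨v, hv⟩ := hx
  ext i j
  have := congrFun h1 i
  simp only [Matrix.mulVec, dotProduct, mul_one, Pi.zero_apply] at this
  simp [Matrix.mul_apply, hv, ← Finset.sum_mul, this]

theorem grad_ineq (f : Matrix (Fin m) (Fin d) ℝ → ℝ) (gf : Matrix (Fin m) (Fin d) ℝ → Matrix (Fin m) (Fin d) ℝ) (hconv : ConvexOn ℝ Set.univ f)
    (hgrad : ∀ x v : Matrix (Fin m) (Fin d) ℝ, HasDerivAt (fun t : ℝ => f (x + t • v)) (ip (gf x) v) 0) (x z : Matrix (Fin m) (Fin d) ℝ) :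
    f x + ip (gf x) (z - x) ≤ f z := by
  have hc : ConvexOn ℝ Set.univ (fun t : ℝ => f (x + t • (z - x))) := by
    refine ⟨convex_univ, fun a _ b _ s t hs ht hst => ?_⟩
    have := hconv.2 (Set.mem_univ (x + a • (z - x))) (Set.mem_univ (x + b • (z - x))) hs ht hst
    convert this using 2
    simp only [smul_eq_mul, smul_add, add_smul, mul_smul]
    have : x = s • x + t • x := by rw [← add_smul, hst, one_smul]
    nth_rewrite 1 [this]
    abel
  have := hc.le_slope_of_hasDerivAt (Set.mem_univ 0) (Set.mem_univ 1) one_pos (hgrad x (z - x))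
  simp [slope_def_field] at this
  linarith

theorem grad_perp (f : Matrix (Fin m) (Fin d) ℝ → ℝ) (gf : Matrix (Fin m) (Fin d) ℝ → Matrix (Fin m) (Fin d) ℝ)
    (hgrad : ∀ x v : Matrix (Fin m) (Fin d) ℝ, HasDerivAt (fun t : ℝ => f (x + t • v)) (ip (gf x) v) 0) (xs : Matrix (Fin m) (Fin d) ℝ)
    (hxsC : xs ∈ cC m d) (hxsMin : ∀ z ∈ cC m d, f xs ≤ f z) : gf xs ∈ cPerp m d := by
  intro j
  obtain ⟨v, hv⟩ := hxsC
  let e : Matrix (Fin m) (Fin d) ℝ := fun _ j' => if j' = j then 1 else 0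
  have hmin : IsLocalMin (fun t : ℝ => f (xs + t • e)) 0 := by
    refine Filter.Eventually.of_forall fun t => ?_
    simp only [zero_smul, add_zero]
    refine hxsMin _ ⟨fun j' => v j' + t * (if j' = j then 1 else 0), fun i j' => ?_⟩
    rw [Matrix.add_apply, Matrix.smul_apply, hv]
    rfl
  have := hmin.hasDerivAt_eq_zero (hgrad xs e)
  simpa [ip, e] using this

theorem exists_dual (B : Matrix (Fin m) (Fin m) ℝ)
    (hB : B.PosSemidef) (hB1 : B.mulVec (fun _ => (1 : ℝ)) = 0)
    (lam2 : ℝ) (hlam2 : 0 < lam2)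
    (hBlow : ∀ z ∈ cPerp m d, lam2 * ip z z ≤ ip (B * z) z) (g : Matrix (Fin m) (Fin d) ℝ) (hg : g ∈ cPerp m d) :
    ∃ p : Matrix (Fin m) (Fin d) ℝ, B * p = g ∧ lam2 * ip (B * p) p ≤ ip g g := by
  let S : Submodule ℝ (Matrix (Fin m) (Fin d) ℝ) :=
    { carrier := cPerp m d
      add_mem' := fun {a b} ha hb j => by
        have h1 := ha j
        have h2 := hb j
        simp [Finset.sum_add_distrib, h1, h2]
      zero_mem' := fun j => by simp
      smul_mem' := fun c a ha j => by
        have h1 := ha j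
        simp [← Finset.mul_sum, h1] }
  let F : Matrix (Fin m) (Fin d) ℝ →ₗ[ℝ] Matrix (Fin m) (Fin d) ℝ :=
    { toFun := fun z => B * z
      map_add' := fun a b => Matrix.mul_add _ _ _
      map_smul' := fun c a => by simp }
  have hF : ∀ z ∈ S, F z ∈ S := by
    intro z _ j
    let e : Matrix (Fin m) (Fin d) ℝ := fun _ j' => if j' = j then 1 else 0
    have h1 : B * e = 0 := mul_cons B hB1 e ⟨fun j' => if j' = j then 1 else 0, fun _ _ => rfl⟩
    have h2 := ip_mul_symm B hB z e
    rw [h1, ip_comm' z, ip_zero_l] at h2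
    change ∑ i, (B * z) i j = 0
    simpa [ip, e] using h2
  have hinj : Function.Injective (F.restrict hF) := by
    rw [injective_iff_map_eq_zero]
    rintro ⟨z, hz⟩ h
    have h1 : B * z = 0 := congrArg Subtype.val h
    have h2 := hBlow z hz
    rw [h1, ip_zero_l] at h2
    have h3 := ip_self_nonneg z
    have : z = 0 := ip_self_eq_zero z (by nlinarith)
    exact Subtype.ext this
  obtain ⟨⟨p, hp⟩, h⟩ := (LinearMap.injective_iff_surjective.1 hinj) ⟨g, hg⟩
  have h1 : B * p = g := congrArg Subtype.val h
  refine ⟨p, h1, ?_⟩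
  have h2 := hBlow p hp
  have h3 := ip_self_nonneg (g - lam2 • p)
  rw [h1] at h2 ⊢
  simp only [ip_sub_l, ip_sub_r, ip_smul_l, ip_smul_r, ip_comm' p g] at h3
  nlinarith

theorem Q_nonneg (A : Matrix (Fin m) (Fin m) ℝ)
    (hA : A.PosSemidef) (hIA : ((1 : Matrix (Fin m) (Fin m) ℝ) - A).PosSemidef) (a : Matrix (Fin m) (Fin d) ℝ) :
    0 ≤ ip ((1 - A) * a) (A * a) := by
  have h1 := ip_psd _ hA ((1 - A) * a)
  have h2 := ip_psd _ hIA (A * a)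
  have h3 : (1 - A) * (A * a) = A * ((1 - A) * a) := by
    simp [Matrix.sub_mul, Matrix.mul_sub]
  rw [h3] at h2
  have h4 : a = A * a + (1 - A) * a := by simp [Matrix.sub_mul]
  have h5 := ip_mul_symm A hA ((1 - A) * a) a
  rw [← h5]
  nth_rewrite 2 [h4]
  rw [ip_add_r]
  linarith

theorem Q_symm (A : Matrix (Fin m) (Fin m) ℝ)
    (hA : A.PosSemidef) (hIA : ((1 : Matrix (Fin m) (Fin m) ℝ) - A).PosSemidef) (a b : Matrix (Fin m) (Fin d) ℝ) :
    ip ((1 - A) * a) (A * b) = ip ((1 - A) * b) (A * a) := by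
  rw [ip_mul_symm _ hIA, ip_comm' _ (A * a), ip_mul_symm _ hA]
  congr 1
  simp [Matrix.sub_mul, Matrix.mul_sub]

theorem Q_conv (A : Matrix (Fin m) (Fin m) ℝ)
    (hA : A.PosSemidef) (hIA : ((1 : Matrix (Fin m) (Fin m) ℝ) - A).PosSemidef) (a b : Matrix (Fin m) (Fin d) ℝ)
    (t : ℝ) (ht0 : 0 ≤ t) (ht : t ≤ 1) :
    ip ((1 - A) * a) (A * a) / 2 - (1 - t) * ip ((1 - A) * b) (A * b) / 2 ≤
    ip ((1 - A) * a) (A * a) - (1 - t) * ip ((1 - A) * a) (A * b) := by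
  have h1 := Q_nonneg A hA hIA (a - b)
  have h2 := Q_nonneg A hA hIA a
  rw [Matrix.mul_sub, Matrix.mul_sub A] at h1
  simp only [ip_sub_l, ip_sub_r] at h1
  rw [Q_symm A hA hIA b a] at h1
  nlinarith [mul_nonneg (sub_nonneg.2 ht) h1, mul_nonneg ht0 h2]

theorem alg_step (t γ τ L lam G' G Qa Qv XX XY YY wY pY bXX bXY bYY gY qY W : ℝ)
    (ht0 : 0 < t) (hγ : 0 < γ) (hτ : 0 < τ)
    (hstep : L + τ * lam / t ^ 2 ≤ 1 / γ)
    (e1 : G' ≤ (1 - t) * G + t * (gY + pY) + L / 2 * t ^ 2 * (YY - 2 * XY + XX))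
    (e2 : γ * gY = - t * (YY - XY) - qY - γ * wY - γ * τ / t * bXY)
    (e4 : Qa / 2 - (1 - t) * Qv / 2 ≤ t * qY)
    (e5 : bYY - 2 * bXY + bXX ≤ lam * (YY - 2 * XY + XX))
    (e6 : 0 ≤ bXX) (e7 : 0 ≤ YY - 2 * XY + XX) :
    G' / t ^ 2 + Qa / (2 * γ) / t ^ 2 + YY / (2 * γ)
      + (W + 2 * (τ / t) * (wY - pY) + (τ / t) ^ 2 * bYY) / (2 * τ) ≤
    (1 - t) / t ^ 2 * (G + Qv / (2 * γ)) + XX / (2 * γ) + W / (2 * τ) := by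
  have hg : gY = (- t * (YY - XY) - qY - γ * wY - γ * τ / t * bXY) / γ := by
    rw [← e2]; field_simp
  have id1 : ((1 - t) / t ^ 2 * (G + Qv / (2 * γ)) + XX / (2 * γ) + W / (2 * τ))
      - (G' / t ^ 2 + Qa / (2 * γ) / t ^ 2 + YY / (2 * γ)
      + (W + 2 * (τ / t) * (wY - pY) + (τ / t) ^ 2 * bYY) / (2 * τ)) =
      (1 / t ^ 2) * ((1 - t) * G + t * (gY + pY) + L / 2 * t ^ 2 * (YY - 2 * XY + XX) - G')
      + (1 / (γ * t ^ 2)) * (t * qY - (Qa / 2 - (1 - t) * Qv / 2))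
      + (τ / (2 * t ^ 2)) * (lam * (YY - 2 * XY + XX) - (bYY - 2 * bXY + bXX))
      + (τ / (2 * t ^ 2)) * bXX
      + (1 / γ - (L + τ * lam / t ^ 2)) * (YY - 2 * XY + XX) / 2 := by
    rw [hg]; field_simp; ring
  have p1 := mul_nonneg (show 0 ≤ 1 / t ^ 2 by positivity) (sub_nonneg.2 e1)
  have p2 := mul_nonneg (show 0 ≤ 1 / (γ * t ^ 2) by positivity) (sub_nonneg.2 e4)
  have p3 := mul_nonneg (show 0 ≤ τ / (2 * t ^ 2) by positivity) (sub_nonneg.2 e5)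
  have p4 := mul_nonneg (show 0 ≤ τ / (2 * t ^ 2) by positivity) e6
  have p5 := mul_nonneg (sub_nonneg.2 hstep) e7
  linarith

theorem one_step (f : Matrix (Fin m) (Fin d) ℝ → ℝ) (gf : Matrix (Fin m) (Fin d) ℝ → Matrix (Fin m) (Fin d) ℝ)
    (L_f : ℝ) (hconv : ConvexOn ℝ Set.univ f)
    (hgrad : ∀ x v : Matrix (Fin m) (Fin d) ℝ, HasDerivAt (fun t : ℝ => f (x + t • v)) (ip (gf x) v) 0)
    (hsmooth : ∀ z w : Matrix (Fin m) (Fin d) ℝ,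
      f w ≤ f z + ip (gf z) (w - z) + L_f / 2 * ip (w - z) (w - z))
    (A B : Matrix (Fin m) (Fin m) ℝ)
    (hA : A.PosSemidef) (hIA : ((1 : Matrix (Fin m) (Fin m) ℝ) - A).PosSemidef)
    (hA1 : ((1 : Matrix (Fin m) (Fin m) ℝ) - A).mulVec (fun _ => (1 : ℝ)) = 0)
    (hB : B.PosSemidef)
    (lamMax : ℝ) (hBup : ∀ z : Matrix (Fin m) (Fin d) ℝ, ip (B * z) z ≤ lamMax * ip z z)
    (xs p : Matrix (Fin m) (Fin d) ℝ) (hxsC : xs ∈ cC m d) (hp : B * p = - gf xs)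
    (t γ τ : ℝ) (ht0 : 0 < t) (ht : t ≤ 1) (hγ : 0 < γ) (hτ : 0 < τ)
    (hstep : L_f + τ * lamMax / t ^ 2 ≤ 1 / γ)
    (u u' x X Y w yh a v : Matrix (Fin m) (Fin d) ℝ)
    (hyh : yh = B * w + (τ / t) • (B * X))
    (ha : a = x - γ • (gf x + yh)) (hu' : u' = A * a) (hv : (1 - t) • u = (1 - t) • (A * v))
    (hux : u' - x = t • (Y - X)) (huu : u' = (1 - t) • u + t • (Y + xs)) :
    breg f gf u' xs / t ^ 2 + ip ((1 - A) * a) (A * a) / (2 * γ) / t ^ 2 + ip Y Y / (2 * γ)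
      + ip (B * (w + (τ / t) • Y - p)) (w + (τ / t) • Y - p) / (2 * τ) ≤
    (1 - t) / t ^ 2 * (breg f gf u xs + ip ((1 - A) * v) (A * v) / (2 * γ)) + ip X X / (2 * γ)
      + ip (B * (w - p)) (w - p) / (2 * τ) := by
  -- (1) descent inequality
  have e1 : breg f gf u' xs ≤ (1 - t) * breg f gf u xs + t * (ip (gf x) Y + ip (B * p) Y)
      + L_f / 2 * t ^ 2 * ip (Y - X) (Y - X) := by
    have s1 := hsmooth x u'
    have s2 := grad_ineq f gf hconv hgrad x u
    have s3 := grad_ineq f gf hconv hgrad x xs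
    have s4 : ip (u' - x) (u' - x) = t ^ 2 * ip (Y - X) (Y - X) := by
      rw [hux, ip_smul_l, ip_smul_r]; ring
    rw [s4] at s1
    have s5 : ∀ g : Matrix (Fin m) (Fin d) ℝ, ip g u' = (1 - t) * ip g u + t * (ip g Y + ip g xs) := by
      intro g
      conv_lhs => rw [huu]
      simp only [ip_add_r, ip_smul_r]
    simp only [breg, hp, ip_neg_l]
    simp only [ip_sub_r (gf x), ip_sub_r (gf xs)] at *
    rw [s5 (gf x)] at s1
    rw [s5 (gf xs)]
    nlinarith [mul_le_mul_of_nonneg_left s2 (sub_nonneg.2 ht), mul_le_mul_of_nonneg_left s3 ht0.le]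
  -- (2) gradient expression
  have e2 : γ * ip (gf x) Y = - t * ip (Y - X) Y - ip ((1 - A) * a) Y - γ * ip (B * w) Y
      - γ * τ / t * ip (B * X) Y := by
    have h : γ • gf x = - (t • (Y - X)) - (1 - A) * a - γ • yh := by
      rw [← hux, hu', Matrix.sub_mul, Matrix.one_mul]
      nth_rewrite 2 [ha]
      rw [smul_add]
      abel
    have h2 := congrArg (fun z => ip z Y) h
    simp only [ip_smul_l, ip_sub_l, ip_neg_l, hyh, ip_add_l] at h2
    simp only [ip_sub_l]
    linear_combination h2
  -- (4)
  have e4 : ip ((1 - A) * a) (A * a) / 2 - (1 - t) * ip ((1 - A) * v) (A * v) / 2 ≤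
      t * ip ((1 - A) * a) Y := by
    have h := Q_conv A hA hIA a v t ht0.le ht
    have h1 : ip ((1 - A) * a) xs = 0 := by
      rw [ip_mul_symm _ hIA, mul_cons _ hA1 xs hxsC, ip_comm', ip_zero_l]
    have h2 := congrArg (fun z => ip ((1 - A) * a) z) huu
    simp only [hv] at h2
    rw [hu'] at h2
    simp only [ip_add_r, ip_smul_r, h1] at h2
    linarith
  have e5 := hBup (Y - X)
  have e6 := ip_psd B hB X
  have e7 := ip_self_nonneg (Y - X)
  have symB : ∀ a b : Matrix (Fin m) (Fin d) ℝ, ip (B * a) b = ip (B * b) a := fun a b => by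
    rw [ip_mul_symm B hB, ip_comm']
  have hW : ip (B * (w + (τ / t) • Y - p)) (w + (τ / t) • Y - p) =
      ip (B * (w - p)) (w - p) + 2 * (τ / t) * (ip (B * w) Y - ip (B * p) Y)
       + (τ / t) ^ 2 * ip (B * Y) Y := by
    simp only [Matrix.mul_sub, Matrix.mul_add, Matrix.mul_smul, ip_add_l, ip_sub_l, ip_add_r,
      ip_sub_r, ip_smul_l, ip_smul_r]
    rw [symB Y w, symB Y p, symB p w]
    ring
  rw [hW]
  have hD : ip (Y - X) (Y - X) = ip Y Y - 2 * ip X Y + ip X X := by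
    simp only [ip_sub_l, ip_sub_r]
    rw [ip_comm' Y X]; ring
  have hBD : ip (B * (Y - X)) (Y - X) = ip (B * Y) Y - 2 * ip (B * X) Y + ip (B * X) X := by
    simp only [Matrix.mul_sub, ip_sub_l, ip_sub_r]
    rw [symB Y X]; ring
  rw [hBD, hD] at e5
  rw [hD] at e7 e1
  rw [ip_sub_l] at e2
  exact alg_step t γ τ L_f lamMax _ _ _ _ _ _ _ _ _ _ _ _ _ _ _ ht0 hγ hτ hstep e1 e2 e4 e5 e6 e7

theorem theta_facts (θ : ℕ → ℝ) (hθpos : ∀ k ≥ 1, 0 < θ k) (hθ1 : θ 1 = 1)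
    (hθrec : ∀ k ≥ 1, 1 / θ (k + 1) = (1 + Real.sqrt (1 + 4 / θ k ^ 2)) / 2) (k : ℕ) (hk : 1 ≤ k) :
    ((k : ℝ) + 1) / 2 ≤ 1 / θ k ∧ 1 / θ k ≤ k ∧
      (1 - θ (k + 1)) / θ (k + 1) ^ 2 = 1 / θ k ^ 2 := by
  have key : ∀ k ≥ 1, 1 / θ k + 1 / 2 ≤ 1 / θ (k+1) ∧ 1 / θ (k+1) ≤ 1 / θ k + 1 := by
    intro k hk
    have hp := hθpos k hk
    rw [hθrec k hk]
    have h0 : 0 < 1 / θ k := by positivity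
    have h4 : 1 + 4 / θ k ^ 2 = 1 + (2 * (1 / θ k)) ^ 2 := by field_simp; norm_num
    rw [h4]
    constructor
    · have : 2 * (1 / θ k) ≤ Real.sqrt (1 + (2 * (1 / θ k)) ^ 2) :=
        Real.le_sqrt_of_sq_le (by linarith)
      linarith
    · have : Real.sqrt (1 + (2 * (1 / θ k)) ^ 2) ≤ 1 + 2 * (1 / θ k) := by
        rw [Real.sqrt_le_left (by positivity)]; nlinarith
      linarith
  have bd : ((k : ℝ) + 1) / 2 ≤ 1 / θ k ∧ 1 / θ k ≤ k := by
    induction k, hk using Nat.le_induction with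
    | base => rw [hθ1]; norm_num
    | succ n hn ih =>
      have := key n hn
      push_cast
      constructor <;> linarith [ih.1, ih.2]
  refine ⟨bd.1, bd.2, ?_⟩
  have hp := hθpos k hk
  have hp1 := hθpos (k+1) (by omega)
  have h := hθrec k hk
  have hs := Real.sq_sqrt (show 0 ≤ 1 + 4 / θ k ^ 2 by positivity)
  have h2 : Real.sqrt (1 + 4 / θ k ^ 2) = 2 * (1 / θ (k+1)) - 1 := by linarith
  rw [h2] at hs
  have h3 : (1 - θ (k + 1)) / θ (k + 1) ^ 2 = (1 / θ (k+1)) ^ 2 - 1 / θ (k+1) := by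
    field_simp
  have h4 : 4 / θ k ^ 2 = 4 * (1 / θ k ^ 2) := by ring
  rw [h3]
  linarith

end helpers

theorem stmt_13 {m d : ℕ} (f : Matrix (Fin m) (Fin d) ℝ → ℝ)
    (gf : Matrix (Fin m) (Fin d) ℝ → Matrix (Fin m) (Fin d) ℝ)
    (L_f : ℝ) (hLf : 0 < L_f)
    (hconv : ConvexOn ℝ Set.univ f)
    (hgrad : ∀ x v : Matrix (Fin m) (Fin d) ℝ,
      HasDerivAt (fun t : ℝ => f (x + t • v)) (ip (gf x) v) 0)
    (hsmooth : ∀ z w : Matrix (Fin m) (Fin d) ℝ,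
      f w ≤ f z + ip (gf z) (w - z) + L_f / 2 * ip (w - z) (w - z))
    (A B : Matrix (Fin m) (Fin m) ℝ)
    (hA : A.PosSemidef) (hIA : ((1 : Matrix (Fin m) (Fin m) ℝ) - A).PosSemidef)
    (hA1 : ((1 : Matrix (Fin m) (Fin m) ℝ) - A).mulVec (fun _ => (1 : ℝ)) = 0)
    (hB : B.PosSemidef) (hB1 : B.mulVec (fun _ => (1 : ℝ)) = 0)
    (lam2 lamMax : ℝ) (hlam2 : 0 < lam2) (hle : lam2 ≤ lamMax)
    (hBup : ∀ z : Matrix (Fin m) (Fin d) ℝ, ip (B * z) z ≤ lamMax * ip z z)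
    (hBlow : ∀ z ∈ cPerp m d, lam2 * ip z z ≤ ip (B * z) z)
    (θ : ℕ → ℝ) (hθpos : ∀ k ≥ 1, 0 < θ k) (hθ1 : θ 1 = 1)
    (hθrec : ∀ k ≥ 1, 1 / θ (k + 1) = (1 + Real.sqrt (1 + 4 / θ k ^ 2)) / 2)
    (T : ℕ) (hT : 2 ≤ T)
    (η ν γ τ : ℝ)
    (hη : η = lam2 / lamMax) (hν : ν = Real.sqrt η)
    (hγ : γ = ν / (ν * L_f + T)) (hτ : τ = 1 / (ν * T * lamMax))
    (u uh x xh y yh : ℕ → Matrix (Fin m) (Fin d) ℝ)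
    (hu1 : u 1 = x 1) (hxh1 : xh 1 = x 1) (hy1 : y 1 = 0)
    (hyh1 : yh 1 = τ • (B * x 1))
    (huh : ∀ k ≥ 1, uh k = x k - γ • (gf (x k) + yh k))
    (hu : ∀ k ≥ 1, u (k + 1) = A * uh k)
    (hx : ∀ k ≥ 1, x (k + 1) =
      u (k + 1) + (θ (k + 1) / θ k - θ (k + 1)) • (u (k + 1) - u k))
    (hxh : ∀ k ≥ 1, xh (k + 1) =
      (1 / θ (k + 1)) • x (k + 1) + (1 - 1 / θ (k + 1)) • u (k + 1))
    (hy : ∀ k ≥ 1, y (k + 1) = y k + (τ / θ k) • (B * xh (k + 1)))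
    (hyh : ∀ k ≥ 1, yh (k + 1) = y (k + 1) + (θ k / θ (k + 1)) • (y (k + 1) - y k))
    (xs : Matrix (Fin m) (Fin d) ℝ)
    (hxsC : xs ∈ cC m d) (hxsMin : ∀ z ∈ cC m d, f xs ≤ f z)
    (Rx Ry : ℝ) (hRx : Rx = ip (u 1 - xs) (u 1 - xs))
    (hRy : Ry = ip (gf xs) (gf xs)) :
    breg f gf (u T) xs ≤
      2 * L_f * Rx / (T : ℝ) ^ 2 + 2 * (Rx + Ry) / (Real.sqrt η * T) := by
  have hlM : 0 < lamMax := by linarith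
  have hη0 : 0 < η := by rw [hη]; positivity
  have hν0 : 0 < ν := by rw [hν]; exact Real.sqrt_pos.2 hη0
  have hν2 : ν ^ 2 = lam2 / lamMax := by rw [hν, Real.sq_sqrt hη0.le, hη]
  have hT0 : (0 : ℝ) < T := by exact_mod_cast (show 0 < T by omega)
  have hγ0 : 0 < γ := by rw [hγ]; positivity
  have hτ0 : 0 < τ := by rw [hτ]; positivity
  have hθf := theta_facts θ hθpos hθ1 hθrec
  obtain ⟨p, hp, hpR⟩ := exists_dual B hB hB1 lam2 hlam2 hBlow (- gf xs) (by
    intro j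
    have := grad_perp f gf hgrad xs hxsC hxsMin j
    simp [this])
  have hpR' : lam2 * ip (B * p) p ≤ Ry := by
    refine hpR.trans (le_of_eq ?_)
    rw [hRy, ip_neg_l, ip_comm', ip_neg_l]; ring
  have hBxs : B * xs = 0 := mul_cons B hB1 xs hxsC
  -- dual potential sequence
  let w : ℕ → Matrix (Fin m) (Fin d) ℝ := fun k =>
    ∑ i ∈ Finset.Ico 1 k, (τ / θ i) • (xh (i + 1) - xs)
  have hw1 : w 1 = 0 := by simp [w]
  have hws : ∀ k ≥ 1, w (k + 1) = w k + (τ / θ k) • (xh (k + 1) - xs) := fun k hk =>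
    Finset.sum_Ico_succ_top hk _
  have hyw : ∀ k ≥ 1, y k = B * w k := by
    intro k hk
    induction k, hk using Nat.le_induction with
    | base => rw [hy1, hw1, Matrix.mul_zero]
    | succ n hn ih =>
      rw [hy n hn, hws n hn, ih, Matrix.mul_add, Matrix.mul_smul, Matrix.mul_sub, hBxs, sub_zero]
  have hyhw : ∀ k ≥ 1, yh k = B * w k + (τ / θ k) • (B * (xh k - xs)) := by
    intro k hk
    rw [Matrix.mul_sub, hBxs, sub_zero]
    rcases Nat.lt_or_ge 1 k with h | h
    · obtain ⟨n, rfl⟩ : ∃ n, k = n + 1 := ⟨k - 1, by omega⟩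
      have hn : 1 ≤ n := by omega
      have h1 := hθpos n hn
      have h2 := hθpos (n + 1) hk
      rw [hyh n hn, ← hyw _ hk, hy n hn, add_sub_cancel_left, smul_smul]
      congr 2
      field_simp
    · obtain rfl : k = 1 := by omega
      rw [hyh1, hw1, hθ1, hxh1]; simp
  -- primal facts
  have hxx : ∀ k ≥ 1, x k = (1 - θ k) • u k + θ k • xh k := by
    intro k hk
    rcases Nat.lt_or_ge 1 k with h | h
    · obtain ⟨n, rfl⟩ : ∃ n, k = n + 1 := ⟨k - 1, by omega⟩
      have h2 := hθpos (n + 1) hk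
      rw [hxh n (by omega), smul_add, smul_smul, smul_smul]
      have e1 : θ (n + 1) * (1 / θ (n + 1)) = 1 := by field_simp
      have e2 : θ (n + 1) * (1 - 1 / θ (n + 1)) = θ (n + 1) - 1 := by field_simp
      rw [e1, e2]; module
    · obtain rfl : k = 1 := by omega
      rw [hθ1, hxh1]; simp
  have huu : ∀ k ≥ 1, u (k + 1) = (1 - θ k) • u k + θ k • xh (k + 1) := by
    intro k hk
    have h1 := hθpos k hk
    have h2 := hθpos (k + 1) (by omega)
    have e := hx k hk
    rw [hxx (k + 1) (by omega)] at e
    have e' : θ (k + 1) • xh (k + 1) = θ (k + 1) • (u (k + 1) + (1 / θ k - 1) • (u (k + 1) - u k)) := by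
      have e3 : θ (k + 1) / θ k - θ (k + 1) = θ (k + 1) * (1 / θ k - 1) := by field_simp
      rw [e3, mul_smul] at e
      have := congrArg (fun z => z - (1 - θ (k + 1)) • u (k + 1)) e
      simp only [add_sub_cancel_left] at this
      rw [this]; module
    have e2 := smul_right_injective _ h2.ne' e'
    rw [e2, smul_add, smul_smul]
    have e4 : θ k * (1 / θ k - 1) = 1 - θ k := by field_simp
    rw [e4]; module
  let v : ℕ → Matrix (Fin m) (Fin d) ℝ := fun k => if k = 1 then 0 else uh (k - 1)
  have hv : ∀ k ≥ 1, (1 - θ k) • u k = (1 - θ k) • (A * v k) := by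
    intro k hk
    rcases Nat.lt_or_ge 1 k with h | h
    · obtain ⟨n, rfl⟩ : ∃ n, k = n + 1 := ⟨k - 1, by omega⟩
      have hn : n ≠ 0 := by omega
      rw [hu n (by omega)]; simp [v, hn]
    · obtain rfl : k = 1 := by omega
      rw [hθ1]; simp
  have hvs : ∀ k ≥ 1, v (k + 1) = uh k := by
    intro k hk
    have hn : k ≠ 0 := by omega
    simp [v, hn]
  have hθle : ∀ k ≥ 1, θ k ≤ 1 := by
    intro k hk
    have h1 := (hθf k hk).1
    have h2 := hθpos k hk
    have h3 : (1 : ℝ) ≤ k := by exact_mod_cast hk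
    rw [le_div_iff₀ h2] at h1
    nlinarith
  have step : ∀ k ≥ 1, k < T →
      breg f gf (u (k + 1)) xs / θ k ^ 2
        + ip ((1 - A) * v (k + 1)) (A * v (k + 1)) / (2 * γ) / θ k ^ 2
        + ip (xh (k + 1) - xs) (xh (k + 1) - xs) / (2 * γ)
        + ip (B * (w (k + 1) - p)) (w (k + 1) - p) / (2 * τ) ≤
      (1 - θ k) / θ k ^ 2 * (breg f gf (u k) xs + ip ((1 - A) * v k) (A * v k) / (2 * γ))
        + ip (xh k - xs) (xh k - xs) / (2 * γ)
        + ip (B * (w k - p)) (w k - p) / (2 * τ) := by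
    intro k hk hkT
    rw [hvs k hk, hws k hk]
    have h2 := hθpos k hk
    refine one_step f gf L_f hconv hgrad hsmooth A B hA hIA hA1 hB lamMax hBup xs p hxsC hp
      (θ k) γ τ h2 (hθle k hk) hγ0 hτ0 ?_ (u k) (u (k + 1)) (x k) (xh k - xs) (xh (k + 1) - xs)
      (w k) (yh k) (uh k) (v k) (hyhw k hk) (huh k hk) (hu k hk) (hv k hk) ?_ ?_
    · have h1 : 1 / θ k ≤ T := (hθf k hk).2.1.trans (by exact_mod_cast hkT.le)
      have h0 : 0 < 1 / θ k := by positivity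
      have e1 : 1 / γ = L_f + T / ν := by rw [hγ]; field_simp
      have e2 : τ * lamMax / θ k ^ 2 = (1 / θ k) ^ 2 / (ν * T) := by rw [hτ]; field_simp
      have e3 : (T : ℝ) / ν = T ^ 2 / (ν * T) := by field_simp
      rw [e1, e2, e3]
      gcongr
    · rw [huu k hk, hxx k hk]; module
    · rw [sub_add_cancel]; exact huu k hk
  have tele : ∀ k ≥ 1, k < T →
      breg f gf (u (k + 1)) xs / θ k ^ 2
        + ip ((1 - A) * v (k + 1)) (A * v (k + 1)) / (2 * γ) / θ k ^ 2
        + ip (xh (k + 1) - xs) (xh (k + 1) - xs) / (2 * γ)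
        + ip (B * (w (k + 1) - p)) (w (k + 1) - p) / (2 * τ) ≤
      Rx / (2 * γ) + ip (B * p) p / (2 * τ) := by
    intro k hk
    induction k, hk using Nat.le_induction with
    | base =>
      intro h
      refine (step 1 le_rfl h).trans (le_of_eq ?_)
      have e : ip (B * (w 1 - p)) (w 1 - p) = ip (B * p) p := by
        rw [hw1, zero_sub, Matrix.mul_neg, ip_neg_l, ip_comm', ip_neg_l, ip_comm']; ring
      rw [e, hθ1, hxh1, hRx, hu1]; ring
    | succ n hn ih =>
      intro h
      refine le_trans (step (n + 1) (by omega) h) (le_trans (le_of_eq ?_) (ih (by omega)))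
      rw [(hθf n hn).2.2]; ring
  obtain ⟨n, rfl⟩ : ∃ n, T = n + 1 := ⟨T - 1, by omega⟩
  have hn : 1 ≤ n := by omega
  have fin := tele n hn (by omega)
  have hq := Q_nonneg A hA hIA (v (n + 1))
  have hxx0 := ip_self_nonneg (xh (n + 1) - xs)
  have hww := ip_psd B hB (w (n + 1) - p)
  have hθn := hθpos n hn
  have q1 : 0 ≤ ip ((1 - A) * v (n + 1)) (A * v (n + 1)) / (2 * γ) / θ n ^ 2 := by positivity
  have q2 : 0 ≤ ip (xh (n + 1) - xs) (xh (n + 1) - xs) / (2 * γ) := by positivity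
  have q3 : 0 ≤ ip (B * (w (n + 1) - p)) (w (n + 1) - p) / (2 * τ) := by positivity
  have hRx0 : 0 ≤ Rx := by rw [hRx]; exact ip_self_nonneg _
  have hRy0 : 0 ≤ Ry := by rw [hRy]; exact ip_self_nonneg _
  rw [← hν]
  have hlo := (hθf n hn).1
  set S : ℝ := ((n + 1 : ℕ) : ℝ) with hS
  have hlo' : S / 2 ≤ 1 / θ n := by rw [hS]; push_cast; exact hlo
  have r1 : Rx / (2 * γ) = L_f * Rx / 2 + S / (2 * ν) * Rx := by rw [hγ]; field_simp
  have r2 : ip (B * p) p / (2 * τ) ≤ S / (2 * ν) * Ry := by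
    have e1 : ip (B * p) p / (2 * τ) = S / (2 * ν) * (ν ^ 2 * lamMax * ip (B * p) p) := by
      rw [hτ]; field_simp
    have e2 : ν ^ 2 * lamMax = lam2 := by rw [hν2]; field_simp
    rw [e1, e2]
    gcongr
  have r3 : breg f gf (u (n + 1)) xs / θ n ^ 2 ≤ L_f * Rx / 2 + S / (2 * ν) * (Rx + Ry) := by
    rw [r1] at fin
    linarith
  have hK : 0 ≤ L_f * Rx / 2 + S / (2 * ν) * (Rx + Ry) := by positivity
  have hth : θ n ^ 2 ≤ (2 / S) ^ 2 := by
    have : θ n ≤ 2 / S := by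
      rw [le_div_iff₀ hT0]
      rw [le_div_iff₀ hθn] at hlo'
      linarith
    gcongr
  rw [div_le_iff₀ (by positivity)] at r3
  refine r3.trans ((mul_le_mul_of_nonneg_left hth hK).trans (le_of_eq ?_))
  field_simp
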